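/- The group G acts transitively on every level of the binary rooted tree: for every n ≥ 0 and every pair of binary words u, v of length n, there exists g ∈ G with g(u) = v. -/

import Mathlib

/-- The tree automorphism `a` as a function: flips the first letter. -/
def aFun : List Bool → List Bool
  | [] => []
  | x :: w => (!x) :: w

mutual
  /-- The tree automorphism `b` as a function. -/
  def bFun : List Bool → List Bool
    | [] => []
    | false :: w => false :: aFun w
    | true :: w => true :: cFun w
  /-- The tree automorphism `c` as a function. -/
  def cFun : List Bool → List Bool
    | [] => []
    | false :: w => false :: bFun w
    | true :: w => true :: w
end

theorem aFun_involutive : Function.Involutive aFun := by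
  intro w
  cases w with
  | nil => rfl
  | cons x t => cases x <;> rfl

theorem bcFun_involutive : ∀ w, bFun (bFun w) = w ∧ cFun (cFun w) = w := by
  intro w
  induction w with
  | nil => exact ⟨rfl, rfl⟩
  | cons x t ih =>
    cases x
    · exact ⟨by simp [bFun, aFun_involutive t], by simp [cFun, ih.1]⟩
    · exact ⟨by simp [bFun, ih.2], by simp [cFun]⟩

/-- The tree automorphism `a` of the binary rooted tree `{0,1}*`. -/
def treeA : Equiv.Perm (List Bool) := Function.Involutive.toPerm aFun aFun_involutive

/-- The tree automorphism `b` of the binary rooted tree `{0,1}*`. -/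
def treeB : Equiv.Perm (List Bool) :=
  Function.Involutive.toPerm bFun (fun w => (bcFun_involutive w).1)

/-- The tree automorphism `c` of the binary rooted tree `{0,1}*`. -/
def treeC : Equiv.Perm (List Bool) :=
  Function.Involutive.toPerm cFun (fun w => (bcFun_involutive w).2)

/-- The group `G = IMG(z²+i)`, the subgroup of `Perm({0,1}*)` generated by `a`, `b`, `c`. -/
def IMG : Subgroup (Equiv.Perm (List Bool)) := Subgroup.closure {treeA, treeB, treeC}

theorem treeA_apply (w : List Bool) : treeA w = aFun w := rfl

theorem treeB_apply (w : List Bool) : treeB w = bFun w := rfl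

theorem treeC_apply (w : List Bool) : treeC w = cFun w := rfl

theorem treeA_mem_IMG : treeA ∈ IMG := Subgroup.subset_closure (by simp)

theorem treeB_mem_IMG : treeB ∈ IMG := Subgroup.subset_closure (by simp)

theorem treeC_mem_IMG : treeC ∈ IMG := Subgroup.subset_closure (by simp)

/-- Every element of `G` is the section at `0` of an element of `G` fixing the first letter `0`. -/
theorem IMG_exists_section_eq {g : Equiv.Perm (List Bool)} (hg : g ∈ IMG) :
    ∃ h ∈ IMG, ∀ w, h (false :: w) = false :: g w := by
  induction hg using Subgroup.closure_induction with
  | mem x hx =>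
    rcases hx with rfl | rfl | rfl
    · exact ⟨treeB, treeB_mem_IMG, fun w => by simp [treeA_apply, treeB_apply, bFun]⟩
    · exact ⟨treeC, treeC_mem_IMG, fun w => by simp [treeB_apply, treeC_apply, cFun]⟩
    · exact ⟨treeA * treeB * treeA,
        mul_mem (mul_mem treeA_mem_IMG treeB_mem_IMG) treeA_mem_IMG,
        fun w => by simp [treeA_apply, treeB_apply, treeC_apply, aFun, bFun]⟩
  | one => exact ⟨1, one_mem _, fun w => rfl⟩
  | mul x y _ _ hx hy =>
    obtain ⟨h, hh, hx⟩ := hx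
    obtain ⟨k, hk, hy⟩ := hy
    exact ⟨h * k, mul_mem hh hk, fun w => by simp [hx, hy]⟩
  | inv x _ hx =>
    obtain ⟨h, hh, hx⟩ := hx
    refine ⟨h⁻¹, inv_mem hh, fun w => ?_⟩
    simp [Equiv.symm_apply_eq, hx]

/-- Every word lies in the `G`-orbit of the all-zero word of the same length. -/
theorem IMG_exists_apply_eq_replicate (u : List Bool) :
    ∃ g ∈ IMG, g u = List.replicate u.length false := by
  induction u with
  | nil => exact ⟨1, one_mem _, rfl⟩
  | cons x t ih =>
    obtain ⟨g, hg, hgt⟩ := ih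
    obtain ⟨h, hh, hhg⟩ := IMG_exists_section_eq hg
    cases x
    · exact ⟨h, hh, by simp [hhg, hgt, List.replicate_succ]⟩
    · exact ⟨h * treeA, mul_mem hh treeA_mem_IMG,
        by simp [treeA_apply, aFun, hhg, hgt, List.replicate_succ]⟩

/-- `G` acts transitively on every level of the binary rooted tree. -/
theorem IMG_level_transitive :
    ∀ (n : ℕ) (u v : List Bool), u.length = n → v.length = n →
      ∃ g ∈ IMG, g u = v := by
  intro n u v hu hv
  obtain ⟨g, hg, hgu⟩ := IMG_exists_apply_eq_replicate u
  obtain ⟨h, hh, hhv⟩ := IMG_exists_apply_eq_replicate v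
  refine ⟨h⁻¹ * g, mul_mem (inv_mem hh) hg, ?_⟩
  rw [Equiv.Perm.mul_apply, Equiv.Perm.inv_eq_iff_eq, hgu, hhv, hu, hv]
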